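/- (Theorem 3.2, decomposition of the m-pursuer one-dimensional game) Let m ≥ 1, r ≥ 0, ρ_a, ρ_b ≥ 0, and for each i = 1, …, m let g_i, h_i, l_i : ℝ → ℝ be continuous with g_i ≥ 0 and h_i ≥ 0. Define the one-dimensional Hamiltonians H_i(s, k) = ρ_a g_i(s)|k| − ρ_b h_i(s)|k| − l_i(s) k − 1 and the full Hamiltonian H(x, p) = ρ_a Σ_{i=1}^m g_i(x_i)|p_i| − ρ_b |Σ_{i=1}^m h_i(x_i) p_i| − Σ_{i=1}^m l_i(x_i) p_i − 1 for x, p ∈ ℝ^m. Suppose that for each i, v_i : ℝ → ℝ is locally Lipschitz continuous, nondecreasing, nonnegative, vanishes on (−∞, r], and is both a viscosity subsolution and a viscosity supersolution of v + H_i(s, v') = 0 on (r, ∞). Then ū(x) = min_{1≤i≤m} v_i(x_i) vanishes on {x ∈ ℝ^m : min_i x_i ≤ r} and is both a viscosity subsolution and a viscosity supersolution of u + H(x, Du) = 0 on the open set {x ∈ ℝ^m : x_i > r for all i}. -/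

import Mathlib

open Filter Topology RealInnerProductSpace

/-- The Fréchet subdifferential of `u : E → ℝ` at `x`. -/
def frechetSubdiff {E : Type*} [NormedAddCommGroup E] [InnerProductSpace ℝ E]
    (u : E → ℝ) (x : E) : Set E :=
  {p | ∀ ε > 0, ∀ᶠ y in 𝓝[≠] x, -ε ≤ (u y - u x - ⟪p, y - x⟫) / ‖y - x‖}

/-- The Fréchet superdifferential of `u : E → ℝ` at `x`. -/
def frechetSuperdiff {E : Type*} [NormedAddCommGroup E] [InnerProductSpace ℝ E]
    (u : E → ℝ) (x : E) : Set E :=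
  {p | ∀ ε > 0, ∀ᶠ y in 𝓝[≠] x, (u y - u x - ⟪p, y - x⟫) / ‖y - x‖ ≤ ε}

/-- `u` is a viscosity subsolution of `u + H(x, Du) = 0` on the open set `Ω`. -/
def IsSubsolution {E : Type*} [NormedAddCommGroup E] [InnerProductSpace ℝ E]
    (H : E → E → ℝ) (u : E → ℝ) (Ω : Set E) : Prop :=
  ∀ x ∈ Ω, ∀ p ∈ frechetSuperdiff u x, u x + H x p ≤ 0

/-- `u` is a viscosity supersolution of `u + H(x, Du) = 0` on the open set `Ω`. -/
def IsSupersolution {E : Type*} [NormedAddCommGroup E] [InnerProductSpace ℝ E]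
    (H : E → E → ℝ) (u : E → ℝ) (Ω : Set E) : Prop :=
  ∀ x ∈ Ω, ∀ p ∈ frechetSubdiff u x, 0 ≤ u x + H x p

section FrechetDifferentials

variable {E : Type*} [NormedAddCommGroup E] [InnerProductSpace ℝ E]

lemma mem_frechetSuperdiff_iff {u : E → ℝ} {x p : E} :
    p ∈ frechetSuperdiff u x ↔
      ∀ ε > 0, ∀ᶠ y in 𝓝 x, u y - u x - ⟪p, y - x⟫ ≤ ε * ‖y - x‖ := by
  refine forall₂_congr fun ε hε => ?_
  rw [eventually_nhdsWithin_iff]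
  refine eventually_congr (Eventually.of_forall fun y => ?_)
  by_cases hy : y = x
  · simp [hy]
  · have : 0 < ‖y - x‖ := norm_pos_iff.2 (sub_ne_zero.2 hy)
    simp [hy, div_le_iff₀ this]

lemma mem_frechetSubdiff_iff_neg {u : E → ℝ} {x p : E} :
    p ∈ frechetSubdiff u x ↔ -p ∈ frechetSuperdiff (fun y => -u y) x := by
  refine forall₂_congr fun ε _ => eventually_congr (Eventually.of_forall fun y => ?_)
  have : (-u y - -u x - ⟪-p, y - x⟫) / ‖y - x‖ = -((u y - u x - ⟪p, y - x⟫) / ‖y - x‖) := by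
    rw [inner_neg_left]; ring
  rw [this, neg_le]

lemma mem_frechetSubdiff_iff {u : E → ℝ} {x p : E} :
    p ∈ frechetSubdiff u x ↔
      ∀ ε > 0, ∀ᶠ y in 𝓝 x, -(ε * ‖y - x‖) ≤ u y - u x - ⟪p, y - x⟫ := by
  rw [mem_frechetSubdiff_iff_neg, mem_frechetSuperdiff_iff]
  refine forall₂_congr fun ε _ => eventually_congr (Eventually.of_forall fun y => ?_)
  rw [inner_neg_left]
  constructor <;> intro h <;> linarith

/-- A lower bound on the directional growth of `u` bounds its supergradients from below. -/
lemma le_inner_of_mem_frechetSuperdiff {u : E → ℝ} {x p d : E} {a : ℝ}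
    (hp : p ∈ frechetSuperdiff u x)
    (h : ∀ ε > 0, ∀ᶠ t : ℝ in 𝓝[>] 0, u x + a * t - ε * t ≤ u (x + t • d)) :
    a ≤ ⟪p, d⟫ := by
  refine le_of_forall_pos_le_add fun δ hδ => ?_
  have hd : 0 < 1 + ‖d‖ := by positivity
  have hlim : Tendsto (fun t : ℝ => x + t • d) (𝓝[>] 0) (𝓝 x) := by
    have : Continuous fun t : ℝ => x + t • d := by fun_prop
    simpa using (this.tendsto 0).mono_left nhdsWithin_le_nhds
  have hε : 0 < δ / (1 + ‖d‖) := by positivity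
  obtain ⟨t, h1, h2, ht⟩ := ((h _ hε).and ((hlim.eventually
    (mem_frechetSuperdiff_iff.1 hp _ hε)).and self_mem_nhdsWithin)).exists
  have ht : 0 < t := ht
  rw [add_sub_cancel_left, inner_smul_right, norm_smul, Real.norm_of_nonneg ht.le] at h2
  have h3 : δ / (1 + ‖d‖) * (1 + ‖d‖) = δ := div_mul_cancel₀ _ hd.ne'
  have h4 : a * t ≤ (⟪p, d⟫ + δ) * t := by
    rw [← h3]; linarith
  exact le_of_mul_le_mul_right h4 ht

/-- If `u` does not grow in the direction `d`, its subgradients are nonpositive on `d`. -/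
lemma inner_nonpos_of_mem_frechetSubdiff {u : E → ℝ} {x p d : E}
    (hp : p ∈ frechetSubdiff u x) (h : ∀ t : ℝ, u (x + t • d) ≤ u x) :
    ⟪p, d⟫ ≤ 0 := by
  have := le_inner_of_mem_frechetSuperdiff (a := 0) (d := d) (mem_frechetSubdiff_iff_neg.1 hp)
    fun ε hε => by
      filter_upwards [self_mem_nhdsWithin] with t ht
      have ht : 0 < t := ht
      have := h t
      have := mul_pos hε ht
      linarith
  rw [inner_neg_left] at this
  linarith

end FrechetDifferentials

lemma HasDerivAt.mem_frechetSuperdiff {v : ℝ → ℝ} {s k : ℝ} (h : HasDerivAt v k s) :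
    k ∈ frechetSuperdiff v s := by
  rw [mem_frechetSuperdiff_iff]
  intro ε hε
  filter_upwards [(hasDerivAt_iff_isLittleO.1 h).def hε] with y hy
  simpa using (le_abs_self _).trans hy

lemma HasDerivAt.mem_frechetSubdiff {v : ℝ → ℝ} {s k : ℝ} (h : HasDerivAt v k s) :
    k ∈ frechetSubdiff v s := by
  rw [mem_frechetSubdiff_iff_neg]
  exact h.neg.mem_frechetSuperdiff

section ScalarEquation

variable {c v : ℝ → ℝ} {r s : ℝ}

/-- If `v + c v' = 1` holds wherever `v` is differentiable, then `v = 1` at the zeros of `c`. -/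
lemma eq_one_of_coeff_eq_zero (hc : Continuous c) (hLip : LocallyLipschitz v) (hmono : Monotone v)
    (heq : ∀ s > r, ∀ k, HasDerivAt v k s → v s + c s * k = 1) (hs : r < s) (hcs : c s = 0) :
    v s = 1 := by
  obtain ⟨K, t, ht, hK⟩ := hLip s
  have hcl : IsClosed {y | |v y - 1| ≤ |c y| * K} := by
    have := hLip.continuous
    exact isClosed_le (by fun_prop) (by fun_prop)
  have hdense := MeasureTheory.Measure.dense_of_ae hmono.ae_differentiableAt
  have hmem : s ∈ closure {y | |v y - 1| ≤ |c y| * K} := by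
    refine mem_closure_iff_frequently.2 ?_
    refine ((mem_closure_iff_frequently.1 (hdense s)).and_eventually
      ((eventually_mem_nhds_iff.2 ht).and (Ioi_mem_nhds hs))).mono ?_
    rintro y ⟨hy, hyt, hyr⟩
    have h1 := heq y hyr _ (DifferentiableAt.hasDerivAt hy)
    have h2 := norm_deriv_le_of_lipschitzOn hyt hK
    have h3 : v y - 1 = -(c y * deriv v y) := by linarith
    change |v y - 1| ≤ |c y| * K
    rw [h3, abs_neg, abs_mul]
    exact mul_le_mul_of_nonneg_left h2 (abs_nonneg _)
  rw [hcl.closure_eq] at hmem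
  have : |v s - 1| ≤ 0 := by simpa [hcs] using hmem
  linarith [abs_nonpos_iff.1 this]

/-- If `v + c v' = 1` holds wherever `v` is differentiable, then `v` is differentiable
wherever `c` does not vanish. -/
lemma hasDerivAt_of_coeff_ne_zero (hc : Continuous c) (hLip : LocallyLipschitz v)
    (hmono : Monotone v) (heq : ∀ s > r, ∀ k, HasDerivAt v k s → v s + c s * k = 1)
    (hs : r < s) (hcs : c s ≠ 0) :
    HasDerivAt v ((1 - v s) / c s) s := by
  have hv := hLip.continuous
  obtain ⟨K, t, ht, hK⟩ := hLip s
  have hnhds : t ∩ (Set.Ioi r ∩ {y | c y ≠ 0}) ∈ 𝓝 s :=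
    inter_mem ht (inter_mem (Ioi_mem_nhds hs) (hc.continuousAt.eventually_ne hcs))
  obtain ⟨δ, hδ, hball⟩ := Metric.mem_nhds_iff.1 hnhds
  set f : ℝ → ℝ := fun y => (1 - v y) / c y with hf
  set a := s - δ / 2 with ha
  have hsub : ∀ b ∈ Metric.ball s (δ / 2), Set.uIcc a b ⊆ Metric.ball s δ := by
    intro b hb y hy
    rw [Real.ball_eq_Ioo] at hb ⊢
    rw [Set.uIcc_of_le hb.1.le] at hy
    constructor <;> linarith [hy.1, hy.2, hb.1, hb.2]
  have hint : ∀ b ∈ Metric.ball s (δ / 2), v b = v a + ∫ y in a..b, f y := by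
    intro b hb
    have h1 := (hK.mono fun y hy => (hball (hsub b hb hy)).1).absolutelyContinuousOnInterval
      |>.integral_deriv_eq_sub
    have h2 : ∫ y in a..b, deriv v y = ∫ y in a..b, f y := by
      refine intervalIntegral.integral_congr_ae ?_
      filter_upwards [hmono.ae_differentiableAt] with y hy hyab
      obtain ⟨-, hyr, hyc⟩ := hball (hsub b hb (Set.uIoc_subset_uIcc hyab))
      have := heq y hyr _ hy.hasDerivAt
      rw [hf, eq_div_iff hyc]
      linarith
    linarith
  have hsball : s ∈ Metric.ball s (δ / 2) := Metric.mem_ball_self (by positivity)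
  have hcont : ContinuousOn f (Set.uIcc a s) :=
    (continuousOn_const.sub hv.continuousOn).div hc.continuousOn
      fun y hy => (hball (hsub s hsball hy)).2.2
  have hmeas : StronglyMeasurableAtFilter f (𝓝 s) :=
    ((measurable_const.sub hv.measurable).div hc.measurable).stronglyMeasurable
      |>.stronglyMeasurableAtFilter
  have hderiv := intervalIntegral.integral_hasDerivAt_right hcont.intervalIntegrable hmeas
    ((continuousAt_const.sub hv.continuousAt).div hc.continuousAt hcs)
  exact (hderiv.const_add (v a)).congr_of_eventuallyEq
    (eventually_of_mem (Metric.isOpen_ball.mem_nhds hsball) hint)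

end ScalarEquation

lemma HasDerivAt.eventually_sub_le {v : ℝ → ℝ} {s k : ℝ} (h : HasDerivAt v k s) (d : ℝ) {ε : ℝ}
    (hε : 0 < ε) : ∀ᶠ t : ℝ in 𝓝[>] 0, v s + k * d * t - ε * t ≤ v (s + t * d) := by
  have hline : HasDerivAt (fun t : ℝ => s + t * d) d 0 := by
    simpa using ((hasDerivAt_id (0 : ℝ)).mul_const d).const_add s
  have hcomp : HasDerivAt (fun t : ℝ => v (s + t * d)) (k * d) 0 :=
    HasDerivAt.comp (0 : ℝ) (by simpa using h) hline
  filter_upwards [((hasDerivAt_iff_isLittleO.1 hcomp).def hε).filter_mono nhdsWithin_le_nhds,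
    self_mem_nhdsWithin] with t ht ht0
  have ht0 : 0 < t := ht0
  simp only [zero_mul, add_zero, sub_zero, smul_eq_mul, Real.norm_eq_abs, abs_of_pos ht0] at ht
  linarith [neg_le_of_abs_le ht]

/-- A monotone locally Lipschitz solution of `v + c v' = 1` grows at rate at least `-(1 - v)` in
the direction `-c`, including where `c` vanishes and `v` need not be differentiable. -/
lemma eventually_le_along_neg_coeff {c v : ℝ → ℝ} {r s : ℝ} (hc : Continuous c)
    (hLip : LocallyLipschitz v) (hmono : Monotone v)
    (heq : ∀ s > r, ∀ k, HasDerivAt v k s → v s + c s * k = 1) (hs : r < s) {ε : ℝ} (hε : 0 < ε) :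
    ∀ᶠ t : ℝ in 𝓝[>] 0, v s + -(1 - v s) * t - ε * t ≤ v (s + t * -c s) := by
  by_cases hcs : c s = 0
  · have h1 := eq_one_of_coeff_eq_zero hc hLip hmono heq hs hcs
    filter_upwards [self_mem_nhdsWithin] with t ht
    have := mul_pos hε ht
    simp only [hcs, h1, neg_zero, mul_zero, add_zero, sub_self, zero_mul]
    linarith
  · have h1 := (hasDerivAt_of_coeff_ne_zero hc hLip hmono heq hs hcs).eventually_sub_le (-c s) hε
    have h2 : (1 - v s) / c s * -c s = -(1 - v s) := by field_simp
    rwa [h2] at h1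

lemma eventually_le_of_lt {v : ℝ → ℝ} {s b : ℝ} (hv : Continuous v) (hb : b < v s) (a d : ℝ) :
    ∀ᶠ t : ℝ in 𝓝[>] 0, b + a * t ≤ v (s + t * d) := by
  have h1 : Continuous fun t : ℝ => b + a * t := by fun_prop
  have h2 : Continuous fun t : ℝ => v (s + t * d) := by fun_prop
  refine ((h1.tendsto 0).eventually_lt (h2.tendsto 0) (by simpa using hb)).filter_mono
    nhdsWithin_le_nhds |>.mono fun t ht => ht.le

section LowerEnvelope

variable {m : ℕ} {v : Fin m → ℝ → ℝ} {x p : EuclideanSpace ℝ (Fin m)}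

lemma lowerEnvelope_le (v : Fin m → ℝ → ℝ) (y : EuclideanSpace ℝ (Fin m)) (i : Fin m) :
    ⨅ j, v j (y j) ≤ v i (y i) :=
  ciInf_le (Set.finite_range _).bddBelow i

lemma le_inner_of_mem_frechetSuperdiff_lowerEnvelope [Nonempty (Fin m)]
    (hp : p ∈ frechetSuperdiff (fun y : EuclideanSpace ℝ (Fin m) => ⨅ i, v i (y i)) x)
    {d : EuclideanSpace ℝ (Fin m)} {a : ℝ}
    (h : ∀ i, ∀ ε > 0, ∀ᶠ t : ℝ in 𝓝[>] 0,
      (⨅ j, v j (x j)) + a * t - ε * t ≤ v i (x i + t * d i)) :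
    a ≤ ⟪p, d⟫ := by
  refine le_inner_of_mem_frechetSuperdiff hp fun ε hε => ?_
  filter_upwards [eventually_all.2 fun i => h i ε hε] with t ht
  exact le_ciInf fun i => by simpa using ht i

lemma nonneg_of_mem_frechetSuperdiff_lowerEnvelope [Nonempty (Fin m)]
    (hmono : ∀ i, Monotone (v i))
    (hp : p ∈ frechetSuperdiff (fun y : EuclideanSpace ℝ (Fin m) => ⨅ i, v i (y i)) x)
    (i : Fin m) : 0 ≤ p i := by
  have := le_inner_of_mem_frechetSuperdiff_lowerEnvelope (a := 0)
    (d := EuclideanSpace.single i 1) hp fun j ε hε => by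
      filter_upwards [self_mem_nhdsWithin] with t ht
      have ht : 0 < t := ht
      have hd : 0 ≤ (EuclideanSpace.single i (1 : ℝ) : EuclideanSpace ℝ (Fin m)) j := by
        rw [PiLp.single_apply]; split_ifs <;> norm_num
      have h1 := hmono j (le_add_of_nonneg_right (a := x j) (mul_nonneg ht.le hd))
      have h2 := lowerEnvelope_le v x j
      have := mul_pos hε ht
      linarith
  simpa [EuclideanSpace.inner_single_right] using this

/-- Every supergradient of the lower envelope satisfies the linear inequality inherited from the
scalar equations `v i + c i * (v i)' = 1`. -/
lemma sum_coeff_mul_le_of_mem_frechetSuperdiff_lowerEnvelope [Nonempty (Fin m)]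
    {c : Fin m → ℝ → ℝ} {r : ℝ} (hc : ∀ i, Continuous (c i))
    (hLip : ∀ i, LocallyLipschitz (v i)) (hmono : ∀ i, Monotone (v i))
    (heq : ∀ i, ∀ s > r, ∀ k, HasDerivAt (v i) k s → v i s + c i s * k = 1)
    (hx : ∀ i, r < x i)
    (hp : p ∈ frechetSuperdiff (fun y : EuclideanSpace ℝ (Fin m) => ⨅ i, v i (y i)) x) :
    ∑ i, c i (x i) * p i ≤ 1 - ⨅ i, v i (x i) := by
  have := le_inner_of_mem_frechetSuperdiff_lowerEnvelope (a := -(1 - ⨅ i, v i (x i)))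
    (d := WithLp.toLp 2 fun i => -c i (x i)) hp fun i ε hε => by
      rcases (lowerEnvelope_le v x i).eq_or_lt with hi | hi
      · rw [hi]
        exact eventually_le_along_neg_coeff (hc i) (hLip i) (hmono i) (heq i) (hx i) hε
      · refine (eventually_le_of_lt (hLip i).continuous hi
          (-(1 - ⨅ j, v j (x j)) - ε) (-c i (x i))).mono fun t ht => ?_
        linarith
  simp only [PiLp.inner_apply, RCLike.inner_apply, conj_trivial, neg_mul,
    Finset.sum_neg_distrib] at this
  linarith

/-- Subgradients of the lower envelope are carried by any single active coordinate. -/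
lemma apply_eq_zero_of_mem_frechetSubdiff_lowerEnvelope
    (hp : p ∈ frechetSubdiff (fun y : EuclideanSpace ℝ (Fin m) => ⨅ i, v i (y i)) x)
    {i j : Fin m} (hi : v i (x i) = ⨅ k, v k (x k)) (hj : j ≠ i) : p j = 0 := by
  have key : ∀ a : ℝ, ⟪p, EuclideanSpace.single j a⟫ ≤ 0 := fun a =>
    inner_nonpos_of_mem_frechetSubdiff hp fun t => by
      have := lowerEnvelope_le v (x + t • EuclideanSpace.single j a) i
      simpa [hj.symm, hi] using this
  have h1 := key 1
  have h2 := key (-1)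
  simp only [EuclideanSpace.inner_single_right, conj_trivial] at h1 h2
  linarith

lemma apply_mem_frechetSubdiff_of_lowerEnvelope
    (hp : p ∈ frechetSubdiff (fun y : EuclideanSpace ℝ (Fin m) => ⨅ i, v i (y i)) x)
    {i : Fin m} (hi : v i (x i) = ⨅ k, v k (x k)) : p i ∈ frechetSubdiff (v i) (x i) := by
  rw [mem_frechetSubdiff_iff] at hp ⊢
  intro ε hε
  have hlim : Tendsto (fun s : ℝ => x + (s - x i) • EuclideanSpace.single i (1 : ℝ))
      (𝓝 (x i)) (𝓝 x) := by
    have : Continuous fun s : ℝ => x + (s - x i) • EuclideanSpace.single i (1 : ℝ) := by fun_prop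
    simpa using this.tendsto (x i)
  filter_upwards [hlim.eventually (hp ε hε)] with s hs
  have h1 := lowerEnvelope_le v (x + (s - x i) • EuclideanSpace.single i (1 : ℝ)) i
  rw [add_sub_cancel_left, norm_smul, inner_smul_right, EuclideanSpace.inner_single_right,
    PiLp.norm_single, norm_one, mul_one, ← hi] at hs
  have h2 : (x + (s - x i) • EuclideanSpace.single i (1 : ℝ)) i = s := by simp
  rw [h2] at h1
  simp only [one_mul, conj_trivial] at hs
  simp only [RCLike.inner_apply, conj_trivial]
  linarith

end LowerEnvelope

/-- Theorem 3.2: decomposition of the `m`-pursuer one-dimensional game.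
The lower envelope `ū(x) = min_i v_i(x_i)` of the extended one-dimensional solutions
vanishes on the target and solves the full Hamilton-Jacobi-Isaacs equation outside it. -/
theorem stmt9 (m : ℕ) (hm : 1 ≤ m) (r ρa ρb : ℝ)
    (hr : 0 ≤ r) (hρa : 0 ≤ ρa) (hρb : 0 ≤ ρb)
    (g h l : Fin m → ℝ → ℝ)
    (hgc : ∀ i, Continuous (g i)) (hhc : ∀ i, Continuous (h i))
    (hlc : ∀ i, Continuous (l i))
    (hg : ∀ i s, 0 ≤ g i s) (hh : ∀ i s, 0 ≤ h i s)
    (Hi : Fin m → ℝ → ℝ → ℝ)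
    (hHi : ∀ i s k, Hi i s k = ρa * g i s * |k| - ρb * h i s * |k| - l i s * k - 1)
    (H : EuclideanSpace ℝ (Fin m) → EuclideanSpace ℝ (Fin m) → ℝ)
    (hHdef : ∀ x p, H x p =
      ρa * ∑ i, g i (x i) * |p i| - ρb * |∑ i, h i (x i) * p i|
        - (∑ i, l i (x i) * p i) - 1)
    (v : Fin m → ℝ → ℝ)
    (hLip : ∀ i, LocallyLipschitz (v i))
    (hmono : ∀ i, Monotone (v i))
    (hnonneg : ∀ i s, 0 ≤ v i s)
    (hvanish : ∀ i, ∀ s ≤ r, v i s = 0)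
    (hvsub : ∀ i, IsSubsolution (Hi i) (v i) (Set.Ioi r))
    (hvsup : ∀ i, IsSupersolution (Hi i) (v i) (Set.Ioi r)) :
    (∀ x : EuclideanSpace ℝ (Fin m), (⨅ i, x i) ≤ r → (⨅ i, v i (x i)) = 0) ∧
    IsSubsolution H (fun x => ⨅ i, v i (x i)) {x | ∀ i, r < x i} ∧
    IsSupersolution H (fun x => ⨅ i, v i (x i)) {x | ∀ i, r < x i} := by
  have : Nonempty (Fin m) := ⟨⟨0, hm⟩⟩
  refine ⟨fun x hx => ?_, fun x hx p hp => ?_, fun x hx p hp => ?_⟩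
  · obtain ⟨i, hi⟩ := exists_eq_ciInf_of_finite (f := fun i => x i)
    refine le_antisymm ?_ (le_ciInf fun i => hnonneg i _)
    exact (lowerEnvelope_le v x i).trans (hvanish i _ (hi.trans_le hx)).le
  · have heq : ∀ i, ∀ s > r, ∀ k, HasDerivAt (v i) k s →
        v i s + (ρa * g i s - ρb * h i s - l i s) * k = 1 := by
      intro i s hs k hk
      have hk0 : 0 ≤ k := hk.deriv ▸ (hmono i).deriv_nonneg
      have h1 := hvsub i s hs k hk.mem_frechetSuperdiff
      have h2 := hvsup i s hs k hk.mem_frechetSubdiff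
      rw [hHi, abs_of_nonneg hk0] at h1 h2
      linarith
    have hp0 := nonneg_of_mem_frechetSuperdiff_lowerEnvelope hmono hp
    have hle := sum_coeff_mul_le_of_mem_frechetSuperdiff_lowerEnvelope
      (c := fun i s => ρa * g i s - ρb * h i s - l i s)
      (fun i => (((hgc i).const_mul ρa).sub ((hhc i).const_mul ρb)).sub (hlc i))
      hLip hmono heq hx hp
    have habs : |∑ i, h i (x i) * p i| = ∑ i, h i (x i) * p i :=
      abs_of_nonneg (Finset.sum_nonneg fun i _ => mul_nonneg (hh i _) (hp0 i))
    have hsum : ∑ i, (ρa * g i (x i) - ρb * h i (x i) - l i (x i)) * p i =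
        ρa * ∑ i, g i (x i) * |p i| - ρb * ∑ i, h i (x i) * p i - ∑ i, l i (x i) * p i := by
      simp only [Finset.mul_sum, ← Finset.sum_sub_distrib]
      refine Finset.sum_congr rfl fun i _ => ?_
      rw [abs_of_nonneg (hp0 i)]
      ring
    rw [hHdef, habs]
    linarith
  · obtain ⟨i, hi⟩ := exists_eq_ciInf_of_finite (f := fun i => v i (x i))
    have hzero : ∀ j, j ≠ i → p j = 0 := fun j hj =>
      apply_eq_zero_of_mem_frechetSubdiff_lowerEnvelope hp hi hj
    have h1 := hvsup i (x i) (hx i) (p i) (apply_mem_frechetSubdiff_of_lowerEnvelope hp hi)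
    have hg1 : ∑ j, g j (x j) * |p j| = g i (x i) * |p i| :=
      Fintype.sum_eq_single i fun j hj => by simp [hzero j hj]
    have hh1 : ∑ j, h j (x j) * p j = h i (x i) * p i :=
      Fintype.sum_eq_single i fun j hj => by simp [hzero j hj]
    have hl1 : ∑ j, l j (x j) * p j = l i (x i) * p i :=
      Fintype.sum_eq_single i fun j hj => by simp [hzero j hj]
    rw [hHi, hi] at h1
    rw [hHdef, hg1, hh1, hl1, abs_mul, abs_of_nonneg (hh i _)]
    linarith
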